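/- Let Γ = Γ_{jkl} be the L^1 kernel built from the fundamental solution of the Laplacian. Then ‖χ(λD)Γ‖_{L^1} = ‖ψ_λ * Γ‖_{L^1} → 0 as λ → +∞; quantitatively, there is a constant C such that for all λ ≥ 2, ‖ψ_λ * Γ‖_{L^1} ≤ C λ^{−1} log(λ) when d = 2, and ‖ψ_λ * Γ‖_{L^1} ≤ C λ^{−1} when d ≥ 3. -/

import Mathlib

open MeasureTheory SchwartzMap Filter Topology Real
open scoped FourierTransform ENNReal

noncomputable section

abbrev Euc (d : ℕ) := EuclideanSpace ℝ (Fin d)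

/-- properties of the low-frequency cut-off function χ -/
structure IsCutoff (d : ℕ) (χ : Euc d → ℝ) : Prop where
  smooth : ContDiff ℝ (⊤ : ℕ∞) χ
  supp : ∀ x : Euc d, 2 ≤ ‖x‖ → χ x = 0
  one_near : ∃ ε > (0:ℝ), ∀ x : Euc d, ‖x‖ ≤ 1 + ε → χ x = 1
  radial_mono : ∀ x y : Euc d, ‖x‖ ≤ ‖y‖ → χ y ≤ χ x

/-- the canonical basis vector e_j of ℝ^d -/
def ee (d : ℕ) (j : Fin d) : Euc d := EuclideanSpace.single j (1:ℝ)

/-- partial derivative ∂_j of a scalar function -/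
def pd {d : ℕ} (j : Fin d) (f : Euc d → ℝ) : Euc d → ℝ :=
  fun x => fderiv ℝ f x (ee d j)

/-- third-order partial derivative ∂_j ∂_k ∂_l -/
def pd3 {d : ℕ} (j k l : Fin d) (f : Euc d → ℝ) : Euc d → ℝ :=
  pd j (pd k (pd l f))

/-- the Laplacian Δf = Σ_i ∂_i ∂_i f -/
def lap {d : ℕ} (f : Euc d → ℝ) : Euc d → ℝ :=
  fun x => ∑ i, pd i (pd i f) x

/-- scalar convolution on ℝ^d -/
def cvS {d : ℕ} (g f : Euc d → ℝ) : Euc d → ℝ :=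
  MeasureTheory.convolution g f (ContinuousLinearMap.mul ℝ ℝ) volume

/-- the dilated kernel `ψ_λ(x) = λ^{-d} ψ(x/λ)` -/
def dil {d : ℕ} (ψ : Euc d → ℝ) (lam : ℝ) : Euc d → ℝ :=
  fun x => (lam ^ d)⁻¹ * ψ (lam⁻¹ • x)

/-- `E` is the fundamental solution of the Laplacian on ℝ^d. -/
structure IsFundSol (d : ℕ) (E : Euc d → ℝ) : Prop where
  form : if d = 2 then (∃ C : ℝ, ∀ x : Euc d, x ≠ 0 → E x = C * Real.log ‖x‖)
         else (∃ C : ℝ, 0 < C ∧ ∀ x : Euc d, x ≠ 0 → E x = C * ‖x‖ ^ (2 - (d:ℝ)))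
  fund : ∀ g : Euc d → ℝ, ContDiff ℝ (⊤ : ℕ∞) g → HasCompactSupport g →
    -∫ x, E x * lap g x = g 0

/-- `θ` is an admissible cut-off. -/
structure IsBump (d : ℕ) (θ : Euc d → ℝ) : Prop where
  smooth : ContDiff ℝ (⊤ : ℕ∞) θ
  cptsupp : HasCompactSupport θ
  nonneg : ∀ x, 0 ≤ θ x
  one_near : ∃ ε > (0:ℝ), ∀ x : Euc d, ‖x‖ ≤ ε → θ x = 1

/-- the kernel `Γ_{jkl} = ψ * ∂_j∂_k∂_l((1-θ)E) + (∂_j∂_k∂_l ψ) * (θE)` -/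
def Gam {d : ℕ} (ψ : Euc d → ℝ) (E : Euc d → ℝ) (θ : Euc d → ℝ)
    (j k l : Fin d) : Euc d → ℝ :=
  fun x =>
    cvS ψ (pd3 j k l (fun y => (1 - θ y) * E y)) x
      + cvS (pd3 j k l ψ) (fun y => θ y * E y) x


open ContinuousLinearMap in
lemma cv_integrable {d : ℕ} {f g : Euc d → ℝ} (hf : Integrable f) (hg : Integrable g) :
    Integrable (cvS f g) := hf.integrable_convolution _ hg

lemma cv_norm_le {d : ℕ} {f g : Euc d → ℝ} (hf : Integrable f) (hg : Integrable g) :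
    ∫ x, ‖cvS f g x‖ ≤ (∫ x, ‖f x‖) * ∫ x, ‖g x‖ := by
  have h := integral_convolution (μ := (volume : Measure (Euc d))) (ν := volume)
    (ContinuousLinearMap.mul ℝ ℝ) hf.norm hg.norm
  simp only [ContinuousLinearMap.mul_apply'] at h
  rw [← h]
  refine integral_mono (cv_integrable hf hg).norm (cv_integrable hf.norm hg.norm) ?_
  intro x
  simp only [cvS, convolution_def, ContinuousLinearMap.mul_apply', ← norm_mul]
  exact norm_integral_le_integral_norm _

lemma cv_assoc {d : ℕ} {f g k : Euc d → ℝ} (hf : Integrable f) (hg : Integrable g)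
    (hk : Integrable k) : cvS (cvS f g) k =ᵐ[volume] cvS f (cvS g k) := by
  filter_upwards [hf.norm.ae_convolution_exists (ContinuousLinearMap.mul ℝ ℝ)
    (cv_integrable hg.norm hk.norm)] with x hx
  exact convolution_assoc _ _ _ _ (fun x y z => by simp [mul_assoc]) hf.1 hg.1 hk.1
    (hf.ae_convolution_exists _ hg) (hg.norm.ae_convolution_exists _ hk.norm) hx

lemma cv_comm {d : ℕ} (f g : Euc d → ℝ) : cvS f g = cvS g f := by
  ext x
  unfold cvS
  rw [convolution_mul_swap, convolution_mul]
  simp_rw [mul_comm]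

lemma cv_add {d : ℕ} {f g k : Euc d → ℝ} (hf : Integrable f) (hg : Integrable g)
    (hk : Integrable k) :
    cvS f (fun x => g x + k x) =ᵐ[volume] fun x => cvS f g x + cvS f k x := by
  filter_upwards [hf.ae_convolution_exists (ContinuousLinearMap.mul ℝ ℝ) hg,
    hf.ae_convolution_exists (ContinuousLinearMap.mul ℝ ℝ) hk] with x h1 h2
  exact h1.distrib_add h2

lemma cv_congr {d : ℕ} {f f' g g' : Euc d → ℝ} (h1 : f =ᵐ[volume] f') (h2 : g =ᵐ[volume] g') :
    cvS f g = cvS f' g' := convolution_congr _ h1 h2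

/-- derivative of Schwartz -/
def sd {d : ℕ} (j : Fin d) (f : 𝓢(Euc d, ℝ)) : 𝓢(Euc d, ℝ) := LineDeriv.lineDerivOp (ee d j) f

lemma sd_coe {d : ℕ} (j : Fin d) (f : 𝓢(Euc d, ℝ)) : ⇑(sd j f) = pd j ⇑f := by
  ext x
  exact SchwartzMap.lineDerivOp_apply_eq_fderiv _ _ _

lemma pd3_coe {d : ℕ} (j k l : Fin d) (f : 𝓢(Euc d, ℝ)) :
    ⇑(sd j (sd k (sd l f))) = pd3 j k l ⇑f := by
  simp only [sd_coe, pd3]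

lemma schwartz_mul_int {d : ℕ} (f g : 𝓢(Euc d, ℝ)) (x : Euc d) :
    Integrable (fun t => f t * g (x - t)) := by
  obtain ⟨C, -, hC⟩ := g.decay 0 0
  refine f.integrable.mul_bdd (c := C) ?_ ?_
  · exact (g.continuous.comp (by fun_prop)).aestronglyMeasurable
  · filter_upwards with t
    simpa using hC (x - t)

lemma cv_pd {d : ℕ} (j : Fin d) (f g : 𝓢(Euc d, ℝ)) : cvS f (pd j g) = cvS (pd j f) g := by
  ext x
  have hd : ∀ t, fderiv ℝ (fun t => g (x - t)) t (ee d j) = - pd j g (x - t) := by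
    intro t
    have h1 : HasFDerivAt (fun t : Euc d => x - t) (-(ContinuousLinearMap.id ℝ (Euc d))) t :=
      (hasFDerivAt_id t).const_sub x
    have h2 := ((g.differentiableAt (x := x - t)).hasFDerivAt.comp t h1).fderiv
    have h3 : (fun t => g (x - t)) = ⇑g ∘ (fun t => x - t) := rfl
    rw [h3, h2]
    simp [pd]
  have h := integral_mul_fderiv_eq_neg_fderiv_mul_of_integrable (μ := (volume : Measure (Euc d)))
    (f := ⇑f) (g := fun t => g (x - t)) (v := ee d j)
    (by have := schwartz_mul_int (sd j f) g x; rw [sd_coe] at this; exact this)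
    (by simp only [hd, ← sd_coe, mul_neg]; exact (schwartz_mul_int f (sd j g) x).neg)
    (schwartz_mul_int f g x) (fun t _ => f.differentiableAt)
    (fun t _ => (g.differentiable.comp (by fun_prop : Differentiable ℝ fun t => x - t)) t)
  simp only [hd, mul_neg, integral_neg, neg_inj] at h
  simpa [cvS, convolution_def, pd] using h

lemma cv_pd3 {d : ℕ} (j k l : Fin d) (f g : 𝓢(Euc d, ℝ)) :
    cvS f (pd3 j k l g) = cvS (pd3 j k l f) g := by
  have e1 : cvS f (pd3 j k l g) = cvS (pd l (pd k (pd j f))) g := by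
    have h1 := cv_pd j f (sd k (sd l g))
    have h2 := cv_pd k (sd j f) (sd l g)
    have h3 := cv_pd l (sd k (sd j f)) g
    simp only [sd_coe] at h1 h2 h3
    rw [pd3, h1, h2, h3]
  have sw : ∀ (a b : Fin d) (f : 𝓢(Euc d, ℝ)), pd a (pd b f) = pd b (pd a f) := by
    intro a b f
    ext x
    have hs : ContDiff ℝ 2 f := f.smooth 2
    have hdf : DifferentiableAt ℝ (fderiv ℝ f) x :=
      ((hs.fderiv_right (m := 1) (by norm_num)).differentiable (by norm_num)) x
    have e : ∀ a b, pd a (pd b f) x = fderiv ℝ (fderiv ℝ f) x (ee d a) (ee d b) := by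
      intro a b
      show fderiv ℝ (fun y => fderiv ℝ f y (ee d b)) x (ee d a) = _
      rw [fderiv_clm_apply hdf (by fun_prop)]
      simp
    rw [e, e]
    exact (hs.contDiffAt.isSymmSndFDerivAt (by simp)).eq _ _
  have h1 := sw l k (sd j f)
  simp only [sd_coe] at h1
  have h2 := sw l j f
  have h3 := sw k j (sd l f)
  simp only [sd_coe] at h3
  rw [e1, h1, h2, h3, pd3]

/-- what we use about the fundamental solution -/
structure EH (d : ℕ) (E : Euc d → ℝ) (C0 : ℝ) : Prop where
  smooth : ∀ x, x ≠ 0 → ContDiffAt ℝ (⊤ : ℕ∞) E x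
  scal : ∀ s : ℝ, 0 < s → ∀ x, x ≠ 0 → E (s • x) = s ^ 2 / s ^ d * E x + C0 * Real.log s
  int : ∀ θ, IsBump d θ → Integrable (fun y => θ y * E y)

lemma pd_congr {d : ℕ} (j : Fin d) {f g : Euc d → ℝ} {x : Euc d} (h : f =ᶠ[𝓝 x] g) :
    pd j f =ᶠ[𝓝 x] pd j g := by
  filter_upwards [h.fderiv (𝕜 := ℝ)] with y hy
  simp [pd, hy]

lemma pd3_congr {d : ℕ} (j k l : Fin d) {f g : Euc d → ℝ} {x : Euc d} (h : f =ᶠ[𝓝 x] g) :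
    pd3 j k l f x = pd3 j k l g x :=
  (pd_congr j (pd_congr k (pd_congr l h))).self_of_nhds

lemma pd_scale {d : ℕ} (j : Fin d) (f : Euc d → ℝ) (a b c : ℝ) :
    pd j (fun x => a * f (b • x) + c) = fun x => (a * b) * pd j f (b • x) + 0 := by
  ext x
  have h1 : (fun x => a * f (b • x)) = a • (fun x => f (b • x)) := rfl
  simp only [pd]
  rw [fderiv_add_const, h1, fderiv_const_smul_field]
  simp [fderiv_comp_smul, mul_assoc]

lemma pd3_scale {d : ℕ} (j k l : Fin d) (f : Euc d → ℝ) (a b c : ℝ) (x : Euc d) :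
    pd3 j k l (fun x => a * f (b • x) + c) x = (a * b ^ 3) * pd3 j k l f (b • x) := by
  simp only [pd3, pd_scale]
  ring

lemma pd_smooth {d : ℕ} (j : Fin d) {f : Euc d → ℝ} (hf : ContDiff ℝ (⊤ : ℕ∞) f) :
    ContDiff ℝ (⊤ : ℕ∞) (pd j f) :=
  (hf.fderiv_right (m := (⊤ : ℕ∞)) (by exact_mod_cast le_rfl)).clm_apply contDiff_const

lemma pd3_smooth {d : ℕ} (j k l : Fin d) {f : Euc d → ℝ} (hf : ContDiff ℝ (⊤ : ℕ∞) f) :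
    ContDiff ℝ (⊤ : ℕ∞) (pd3 j k l f) := pd_smooth j (pd_smooth k (pd_smooth l hf))

lemma pd_add {d : ℕ} (j : Fin d) {f g : Euc d → ℝ} (hf : ContDiff ℝ (⊤ : ℕ∞) f)
    (hg : ContDiff ℝ (⊤ : ℕ∞) g) : pd j (fun x => f x + g x) = fun x => pd j f x + pd j g x := by
  ext x
  simp only [pd]
  rw [fderiv_fun_add ((hf.differentiable (by simp)) x) ((hg.differentiable (by simp)) x)]
  rfl

lemma pd3_add {d : ℕ} (j k l : Fin d) {f g : Euc d → ℝ} (hf : ContDiff ℝ (⊤ : ℕ∞) f)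
    (hg : ContDiff ℝ (⊤ : ℕ∞) g) :
    pd3 j k l (fun x => f x + g x) = fun x => pd3 j k l f x + pd3 j k l g x := by
  simp only [pd3]
  rw [pd_add l hf hg, pd_add k (pd_smooth l hf) (pd_smooth l hg),
    pd_add j (pd_smooth k (pd_smooth l hf)) (pd_smooth k (pd_smooth l hg))]

lemma P_smooth {d : ℕ} {E θ : Euc d → ℝ} {C0 : ℝ} (hE : EH d E C0) (hθ : IsBump d θ) :
    ContDiff ℝ (⊤ : ℕ∞) (fun y => (1 - θ y) * E y) := by
  rw [contDiff_iff_contDiffAt]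
  intro x
  by_cases hx : x = 0
  · subst hx
    obtain ⟨ε, hε, h1⟩ := hθ.one_near
    have : (fun y => (1 - θ y) * E y) =ᶠ[𝓝 0] fun _ => 0 := by
      filter_upwards [Metric.ball_mem_nhds (0 : Euc d) hε] with y hy
      rw [h1 y (by simpa using (mem_ball_zero_iff.1 hy).le)]
      simp
    exact contDiffAt_const.congr_of_eventuallyEq this
  · exact (contDiffAt_const.sub hθ.smooth.contDiffAt).mul (hE.smooth x hx)

lemma bump_R {d : ℕ} {θ : Euc d → ℝ} (hθ : IsBump d θ) :
    ∃ R : ℝ, 1 ≤ R ∧ ∀ x, R ≤ ‖x‖ → θ =ᶠ[𝓝 x] 0 := by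
  obtain ⟨R, hR⟩ := hθ.cptsupp.isCompact.isBounded.subset_closedBall 0
  refine ⟨max 1 (R + 1), le_max_left _ _, fun x hx => ?_⟩
  rw [← notMem_tsupport_iff_eventuallyEq]
  intro h
  have h1 := hR h
  rw [mem_closedBall_zero_iff] at h1
  have h2 := le_max_right 1 (R + 1)
  linarith

lemma A_int {d : ℕ} {E θ : Euc d → ℝ} {C0 : ℝ} (hE : EH d E C0) (hθ : IsBump d θ)
    (j k l : Fin d) : Integrable (pd3 j k l (fun y => (1 - θ y) * E y)) := by
  set A := pd3 j k l (fun y => (1 - θ y) * E y) with hA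
  have hAc : Continuous A := (pd3_smooth j k l (P_smooth hE hθ)).continuous
  obtain ⟨R, hR1, hR⟩ := bump_R hθ
  have hR0 : 0 < R := by linarith
  obtain ⟨M, hM⟩ := (isCompact_closedBall (0 : Euc d) R).exists_bound_of_continuousOn
    hAc.continuousOn
  have hM0 : 0 ≤ M := (norm_nonneg _).trans (hM 0 (by simp [hR0.le]))
  have hAE : ∀ x : Euc d, R ≤ ‖x‖ → A x = pd3 j k l E x := by
    intro x hx
    apply pd3_congr
    filter_upwards [hR x hx] with y hy
    simp [hy]
  have hhom : ∀ x : Euc d, x ≠ 0 → ∀ s : ℝ, 0 < s →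
      s ^ 3 * pd3 j k l E (s • x) = s ^ 2 / s ^ d * pd3 j k l E x := by
    intro x hx s hs
    have h1 := pd3_scale j k l E 1 s 0 x
    have h2 := pd3_scale j k l E (s ^ 2 / s ^ d) 1 (C0 * Real.log s) x
    simp only [one_mul, add_zero, one_pow, mul_one, one_smul] at h1 h2
    rw [← h1, ← h2]
    apply pd3_congr
    filter_upwards [isOpen_ne.mem_nhds hx] with y hy
    exact hE.scal s hs y hy
  have hb : ∀ x, ‖A x‖ ≤ M * (2 * R) ^ (d + 1) * ((1 + ‖x‖) ^ (-((d : ℝ) + 1))) := by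
    intro x
    have e0 : (1 + ‖x‖) ^ (-((d : ℝ) + 1)) = ((1 + ‖x‖) ^ (d + 1))⁻¹ := by
      rw [Real.rpow_neg (by positivity)]
      congr 1
      exact_mod_cast Real.rpow_natCast (1 + ‖x‖) (d + 1)
    rw [e0, mul_assoc, ← div_eq_mul_inv, ← div_pow]
    by_cases hx : ‖x‖ ≤ R
    · refine (hM x (by simpa using hx)).trans ?_
      refine le_mul_of_one_le_right hM0 (one_le_pow₀ ?_)
      rw [le_div_iff₀ (by positivity)]
      linarith
    · push Not at hx
      set s := ‖x‖ / R with hs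
      have hs0 : 0 < s := div_pos (by linarith) hR0
      have hxs : x = s • (s⁻¹ • x) := by rw [smul_smul, mul_inv_cancel₀ hs0.ne', one_smul]
      set y := s⁻¹ • x with hy
      have hyn : ‖y‖ = R := by
        rw [hy, norm_smul, norm_inv, Real.norm_of_nonneg hs0.le, hs]
        have : 0 < ‖x‖ := by linarith
        field_simp
      have hy0 : y ≠ 0 := by rw [← norm_pos_iff, hyn]; exact hR0
      have h := hhom y hy0 s hs0
      rw [← hxs, ← hAE x hx.le, ← hAE y hyn.ge] at h
      have h' : A x = (s ^ (d + 1))⁻¹ * A y := by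
        field_simp at h ⊢
        rw [← h]; ring
      rw [h', norm_mul, mul_comm, norm_inv, norm_pow, Real.norm_of_nonneg hs0.le]
      refine mul_le_mul (hM y (by simp [hyn])) ?_ (by positivity) hM0
      rw [← inv_pow]
      refine pow_le_pow_left₀ (by positivity) ?_ _
      rw [hs, inv_div, div_le_div_iff₀ (by linarith) (by positivity)]
      nlinarith
  refine Integrable.mono' ((integrable_one_add_norm (r := (d : ℝ) + 1) ?_).const_mul _)
    hAc.aestronglyMeasurable (Eventually.of_forall hb)
  simp

lemma gam_indep {d : ℕ} {E θ θ' : Euc d → ℝ} {C0 : ℝ} (hE : EH d E C0) (hθ : IsBump d θ)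
    (hθ' : IsBump d θ') (j k l : Fin d) (φ : 𝓢(Euc d, ℝ)) :
    Gam φ E θ j k l =ᵐ[volume] Gam φ E θ' j k l := by
  have hhs : ContDiff ℝ (⊤ : ℕ∞) (fun y => (θ' y - θ y) * E y) := by
    have := (P_smooth hE hθ).sub (P_smooth hE hθ')
    convert! this using 2
    ring
  have hhc : HasCompactSupport (fun y => (θ' y - θ y) * E y) :=
    (hθ'.cptsupp.sub hθ.cptsupp).mul_right
  set h : 𝓢(Euc d, ℝ) := hhc.toSchwartzMap hhs with hh
  have hcoe : ∀ y, h y = (θ' y - θ y) * E y := fun y => rfl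
  have e1 : (fun y => (1 - θ y) * E y) = fun y => (1 - θ' y) * E y + h y := by
    ext y; rw [hcoe]; ring
  have e2 : (fun y => θ' y * E y) = fun y => θ y * E y + h y := by
    ext y; rw [hcoe]; ring
  have h3 := cv_add (φ.integrable (μ := volume)) (A_int hE hθ' j k l)
    (pd3_coe j k l h ▸ (sd j (sd k (sd l h))).integrable)
  have h4 := cv_add (pd3_coe j k l φ ▸ (sd j (sd k (sd l φ))).integrable (μ := volume))
    (hE.int θ hθ) (h.integrable)
  filter_upwards [h3, h4] with x h3 h4
  simp only [Gam]
  rw [e1, pd3_add j k l (P_smooth hE hθ') (h.smooth ⊤), h3, e2, h4, cv_pd3]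
  ring

lemma gam_swap {d : ℕ} {E θ : Euc d → ℝ} {C0 : ℝ} (hE : EH d E C0) (hθ : IsBump d θ)
    (j k l : Fin d) (φ ψ : 𝓢(Euc d, ℝ)) :
    cvS φ (Gam ψ E θ j k l) =ᵐ[volume] cvS ψ (Gam φ E θ j k l) := by
  have hA := A_int hE hθ j k l
  have hF := hE.int θ hθ
  have hI : ∀ φ : 𝓢(Euc d, ℝ), Integrable φ := fun φ => φ.integrable
  have hI3 : ∀ φ : 𝓢(Euc d, ℝ), Integrable (pd3 j k l φ) := fun φ =>
    pd3_coe j k l φ ▸ (sd j (sd k (sd l φ))).integrable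
  have e : cvS φ (pd3 j k l ψ) = cvS ψ (pd3 j k l φ) := by rw [cv_pd3, cv_comm]
  filter_upwards [cv_add (hI φ) (cv_integrable (hI ψ) hA) (cv_integrable (hI3 ψ) hF),
    cv_add (hI ψ) (cv_integrable (hI φ) hA) (cv_integrable (hI3 φ) hF),
    cv_assoc (hI φ) (hI ψ) hA, cv_assoc (hI ψ) (hI φ) hA,
    cv_assoc (hI φ) (hI3 ψ) hF, cv_assoc (hI ψ) (hI3 φ) hF] with x h1 h2 h3 h4 h5 h6
  unfold Gam
  rw [h1, h2, ← h3, ← h4, ← h5, ← h6, e, cv_comm φ ψ]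

lemma scale_int {d : ℕ} {f : Euc d → ℝ} (hf : Integrable f) {s : ℝ} (hs : 0 < s) :
    Integrable (fun x => f (s⁻¹ • x)) :=
  (integrable_comp_smul_iff volume f (inv_ne_zero hs.ne')).2 hf

lemma scale_norm {d : ℕ} (f : Euc d → ℝ) {s : ℝ} (hs : 0 < s) :
    ∫ x, ‖f (s⁻¹ • x)‖ = s ^ d * ∫ x, ‖f x‖ := by
  have := Measure.integral_comp_inv_smul_of_nonneg (volume : Measure (Euc d))
    (fun x => ‖f x‖) (R := s) hs.le
  rw [this]
  simp

lemma comb_int {d : ℕ} {f g : Euc d → ℝ} (hf : Integrable f) (hg : Integrable g) {s : ℝ}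
    (hs : 0 < s) (a b : ℝ) : Integrable (fun x => a * f (s⁻¹ • x) + b * g (s⁻¹ • x)) :=
  ((scale_int hf hs).const_mul a).add ((scale_int hg hs).const_mul b)

lemma comb_norm {d : ℕ} {f g : Euc d → ℝ} (hf : Integrable f) (hg : Integrable g) {s : ℝ}
    (hs : 0 < s) (a b : ℝ) : ∫ x, ‖a * f (s⁻¹ • x) + b * g (s⁻¹ • x)‖ ≤
      |a| * (s ^ d * ∫ x, ‖f x‖) + |b| * (s ^ d * ∫ x, ‖g x‖) := by
  rw [← scale_norm f hs, ← scale_norm g hs, ← integral_const_mul, ← integral_const_mul,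
    ← integral_add ((scale_int hf hs).norm.const_mul _) ((scale_int hg hs).norm.const_mul _)]
  refine integral_mono (comb_int hf hg hs a b).norm
    (((scale_int hf hs).norm.const_mul _).add ((scale_int hg hs).norm.const_mul _)) ?_
  intro x
  refine (norm_add_le _ _).trans ?_
  simp [norm_mul]

lemma dil_schwartz {d : ℕ} (ψ : 𝓢(Euc d, ℝ)) {s : ℝ} (hs : 0 < s) :
    ∃ φ : 𝓢(Euc d, ℝ), ⇑φ = dil ψ s := by
  let g : Euc d ≃L[ℝ] Euc d := ContinuousLinearEquiv.smulLeft (Units.mk0 s⁻¹ (inv_ne_zero hs.ne'))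
  refine ⟨(s ^ d)⁻¹ • SchwartzMap.compCLMOfContinuousLinearEquiv ℝ g ψ, ?_⟩
  ext x
  simp [dil, g]

lemma bump_dil {d : ℕ} {θ : Euc d → ℝ} (hθ : IsBump d θ) {s : ℝ} (hs : 0 < s) :
    IsBump d (fun x => θ (s⁻¹ • x)) where
  smooth := hθ.smooth.comp (contDiff_const_smul s⁻¹)
  cptsupp := hθ.cptsupp.comp_smul (inv_ne_zero hs.ne')
  nonneg := fun x => hθ.nonneg _
  one_near := by
    obtain ⟨ε, hε, h⟩ := hθ.one_near
    refine ⟨s * ε, by positivity, fun x hx => h _ ?_⟩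
    rw [norm_smul, norm_inv, Real.norm_of_nonneg hs.le, inv_mul_le_iff₀ hs]
    exact hx

lemma gam_bound {d : ℕ} {E θ : Euc d → ℝ} {C0 : ℝ} (hE : EH d E C0) (hθ : IsBump d θ)
    (j k l : Fin d) (ψ : 𝓢(Euc d, ℝ)) : ∃ K1 K2 : ℝ, 0 ≤ K1 ∧ 0 ≤ K2 ∧ ∀ s : ℝ, 0 < s →
      Integrable (Gam (dil ψ s) E (fun x => θ (s⁻¹ • x)) j k l) ∧
      ∫ x, ‖Gam (dil ψ s) E (fun x => θ (s⁻¹ • x)) j k l x‖ ≤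
        s⁻¹ * K1 + |C0 * Real.log s| * (s ^ d / s ^ 3) * K2 := by
  have hA := A_int hE hθ j k l
  have hF := hE.int θ hθ
  let θS : 𝓢(Euc d, ℝ) := hθ.cptsupp.toSchwartzMap hθ.smooth
  have hθi : Integrable θ := θS.integrable (μ := volume)
  have hI3 : ∀ φ : 𝓢(Euc d, ℝ), Integrable (pd3 j k l φ) := fun φ =>
    pd3_coe j k l φ ▸ (sd j (sd k (sd l φ))).integrable
  have hθ3 : Integrable (pd3 j k l θ) := hI3 θS
  have hψ : Integrable ψ := ψ.integrable (μ := volume)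
  refine ⟨(∫ x, ‖ψ x‖) * (∫ x, ‖pd3 j k l (fun y => (1 - θ y) * E y) x‖)
      + (∫ x, ‖pd3 j k l ψ x‖) * (∫ x, ‖θ x * E x‖),
    (∫ x, ‖ψ x‖) * (∫ x, ‖pd3 j k l θ x‖) + (∫ x, ‖pd3 j k l ψ x‖) * (∫ x, ‖θ x‖),
    by positivity, by positivity, fun s hs => ?_⟩
  set c := C0 * Real.log s with hc
  have hEs : ∀ x : Euc d, x ≠ 0 → E x = s ^ 2 / s ^ d * E (s⁻¹ • x) + c := by
    intro x hx
    rw [hc, ← hE.scal s hs _ (smul_ne_zero (inv_ne_zero hs.ne') hx), smul_smul,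
      mul_inv_cancel₀ hs.ne', one_smul]
  have hθ0 : θ 0 = 1 := by
    obtain ⟨ε, hε, h⟩ := hθ.one_near
    exact h 0 (by simp [hε.le])
  have eP : (fun x => (1 - θ (s⁻¹ • x)) * E x) = fun x =>
      (s ^ 2 / s ^ d * (fun y => (1 - θ y) * E y) (s⁻¹ • x) + 0) + (-c * θ (s⁻¹ • x) + c) := by
    ext x
    by_cases hx : x = 0
    · simp [hx, hθ0]
    · rw [hEs x hx]; ring
  have eA : pd3 j k l (fun x => (1 - θ (s⁻¹ • x)) * E x) = fun x =>
      (s ^ 2 / s ^ d * s⁻¹ ^ 3) * pd3 j k l (fun y => (1 - θ y) * E y) (s⁻¹ • x)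
        + (-c * s⁻¹ ^ 3) * pd3 j k l θ (s⁻¹ • x) := by
    rw [eP, pd3_add]
    · ext x
      rw [pd3_scale j k l (fun y => (1 - θ y) * E y), pd3_scale j k l θ]
    · exact (contDiff_const.mul ((P_smooth hE hθ).comp (contDiff_const_smul s⁻¹))).add
        contDiff_const
    · exact (contDiff_const.mul (hθ.smooth.comp (contDiff_const_smul s⁻¹))).add contDiff_const
  have eF : (fun x => θ (s⁻¹ • x) * E x) =ᵐ[volume] fun x =>
      (s ^ 2 / s ^ d) * (fun y => θ y * E y) (s⁻¹ • x) + c * θ (s⁻¹ • x) := by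
    have : Nonempty (Fin d) := ⟨j⟩
    have hae : ∀ᵐ x : Euc d, x ≠ 0 := by
      simp [ae_iff]
    filter_upwards [hae] with x hx
    rw [hEs x hx]
    ring
  have eψ3 : pd3 j k l (dil ψ s) = fun x => ((s ^ d)⁻¹ * s⁻¹ ^ 3) * pd3 j k l ψ (s⁻¹ • x) := by
    ext x
    have := pd3_scale j k l ψ (s ^ d)⁻¹ s⁻¹ 0 x
    rw [← this]
    simp only [add_zero]
    rfl
  have i1 : Integrable (dil ψ s) := (scale_int hψ hs).const_mul _
  have i2 : Integrable (pd3 j k l (fun x => (1 - θ (s⁻¹ • x)) * E x)) := by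
    rw [eA]; exact comb_int hA hθ3 hs _ _
  have i3 : Integrable (pd3 j k l (dil ψ s)) := by
    rw [eψ3]; exact (scale_int (hI3 ψ) hs).const_mul _
  have i4 : Integrable (fun x => θ (s⁻¹ • x) * E x) := hE.int _ (bump_dil hθ hs)
  have iG1 := cv_integrable i1 i2
  have iG2 := cv_integrable i3 i4
  refine ⟨iG1.add iG2, ?_⟩
  have n1 : ∫ x, ‖dil ψ s x‖ = ∫ x, ‖ψ x‖ := by
    simp only [dil, norm_mul]
    rw [integral_const_mul, scale_norm ψ hs, Real.norm_of_nonneg (by positivity)]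
    field_simp
  have n3 : ∫ x, ‖pd3 j k l (dil ψ s) x‖ = s⁻¹ ^ 3 * ∫ x, ‖pd3 j k l ψ x‖ := by
    rw [eψ3]
    simp only [norm_mul]
    rw [integral_const_mul, scale_norm (pd3 j k l ψ) hs, ← norm_mul,
      Real.norm_of_nonneg (by positivity)]
    field_simp
  have n2 := comb_norm hA hθ3 hs (s ^ 2 / s ^ d * s⁻¹ ^ 3) (-c * s⁻¹ ^ 3)
  have n4 := comb_norm hF hθi hs (s ^ 2 / s ^ d) c
  rw [abs_of_nonneg (by positivity), abs_mul, abs_neg, abs_of_nonneg (a := s⁻¹ ^ 3)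
    (by positivity)] at n2
  rw [abs_of_nonneg (a := s ^ 2 / s ^ d) (by positivity)] at n4
  have n4' : ∫ x, ‖θ (s⁻¹ • x) * E x‖ = ∫ x, ‖(s ^ 2 / s ^ d) * (fun y => θ y * E y) (s⁻¹ • x)
      + c * θ (s⁻¹ • x)‖ := integral_congr_ae (eF.mono fun x hx => congrArg norm hx)
  rw [← n4'] at n4
  have b1 := cv_norm_le i1 i2
  have b2 := cv_norm_le i3 i4
  rw [n1] at b1
  rw [n3] at b2
  have n2' := n2
  rw [show (fun x => ‖s ^ 2 / s ^ d * s⁻¹ ^ 3 * pd3 j k l (fun y => (1 - θ y) * E y) (s⁻¹ • x) +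
    -c * s⁻¹ ^ 3 * pd3 j k l θ (s⁻¹ • x)‖) =
    fun x => ‖pd3 j k l (fun x => (1 - θ (s⁻¹ • x)) * E x) x‖ by rw [eA]] at n2'
  have m1 : ∫ x, ‖Gam (dil ψ s) E (fun x => θ (s⁻¹ • x)) j k l x‖ ≤
      ∫ x, (‖cvS (dil ψ s) (pd3 j k l (fun x => (1 - θ (s⁻¹ • x)) * E x)) x‖
        + ‖cvS (pd3 j k l (dil ψ s)) (fun x => θ (s⁻¹ • x) * E x) x‖) :=
    integral_mono (iG1.add iG2).norm (iG1.norm.add iG2.norm) fun x => norm_add_le _ _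
  rw [integral_add iG1.norm iG2.norm] at m1
  refine (m1.trans (add_le_add (b1.trans (mul_le_mul_of_nonneg_left n2' (by positivity)))
    (b2.trans (mul_le_mul_of_nonneg_left n4 (by positivity))))).trans (le_of_eq ?_)
  field_simp
  ring

lemma E_hyp {d : ℕ} (hd : 2 ≤ d) {E : Euc d → ℝ} (hE : IsFundSol d E) :
    ∃ C0, (3 ≤ d → C0 = 0) ∧ EH d E C0 := by
  have : Nonempty (Fin d) := ⟨⟨0, by omega⟩⟩
  have key : ∃ C0, (3 ≤ d → C0 = 0) ∧ ∃ e : ℝ → ℝ, (∀ x : Euc d, x ≠ 0 → E x = e ‖x‖) ∧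
      (∀ r, 0 < r → ContDiffAt ℝ (⊤ : ℕ∞) e r) ∧
      (∀ s r : ℝ, 0 < s → 0 < r → e (s * r) = s ^ 2 / s ^ d * e r + C0 * Real.log s) ∧
      (∀ R, IntegrableOn (fun y => y ^ (d - 1) • e y) (Set.Ioo 0 R)) := by
    have hf := hE.form
    split_ifs at hf with h2
    · obtain ⟨C, hC⟩ := hf
      refine ⟨C, by omega, fun r => C * Real.log r, hC, ?_, ?_, ?_⟩
      · intro r hr
        exact contDiffAt_const.mul (Real.contDiffAt_log.2 hr.ne')
      · intro s r hs hr
        subst h2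
        beta_reduce
        rw [Real.log_mul hs.ne' hr.ne', div_self (by positivity)]
        ring
      · intro R
        subst h2
        have : Continuous (fun y : ℝ => C * (y * Real.log y)) :=
          continuous_const.mul Real.continuous_mul_log
        refine ((this.integrableOn_Icc (a := 0) (b := R)).mono_set Set.Ioo_subset_Icc_self).congr_fun
          (fun y _ => ?_) measurableSet_Ioo
        simp
        ring
    · obtain ⟨C, -, hC⟩ := hf
      refine ⟨0, fun _ => rfl, fun r => C * r ^ (2 - (d : ℝ)), hC, ?_, ?_, ?_⟩
      · intro r hr
        exact contDiffAt_const.mul (Real.contDiffAt_rpow_const_of_ne hr.ne')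
      · intro s r hs hr
        beta_reduce
        rw [Real.mul_rpow hs.le hr.le, Real.rpow_sub hs, Real.rpow_natCast]
        norm_num
        ring
      · intro R
        have : Continuous (fun y : ℝ => C * y) := by fun_prop
        refine ((this.integrableOn_Icc (a := 0) (b := R)).mono_set Set.Ioo_subset_Icc_self).congr_fun
          (fun y hy => ?_) measurableSet_Ioo
        have hy0 : 0 < y := hy.1
        obtain ⟨n, rfl⟩ : ∃ n, d = n + 1 := ⟨d - 1, by omega⟩
        simp only [smul_eq_mul]
        rw [Real.rpow_sub hy0, Real.rpow_natCast]
        norm_num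
        field_simp
        ring
  obtain ⟨C0, h0, e, h1, h2, h3, h4⟩ := key
  have hae : ∀ᵐ x : Euc d, x ≠ 0 := by
    simp [ae_iff]
  refine ⟨C0, h0, ?_, ?_, ?_⟩
  · intro x hx
    have hc : ContDiffAt ℝ (⊤ : ℕ∞) (fun y : Euc d => e ‖y‖) x :=
      (h2 _ (norm_pos_iff.2 hx)).comp x (contDiffAt_norm ℝ hx)
    refine hc.congr_of_eventuallyEq ?_
    filter_upwards [isOpen_ne.mem_nhds hx] with y hy
    exact h1 y hy
  · intro s hs x hx
    rw [h1 _ (smul_ne_zero hs.ne' hx), h1 x hx, norm_smul, Real.norm_of_nonneg hs.le,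
      h3 s _ hs (norm_pos_iff.2 hx)]
  · intro θ hθ
    obtain ⟨R, -, hR⟩ := bump_R hθ
    have hI : IntegrableOn (fun x : Euc d => e ‖x‖) (Metric.ball 0 R) := by
      rw [integrableOn_fun_norm_addHaar]
      simpa using h4 R
    rw [← integrable_indicator_iff Metric.isOpen_ball.measurableSet] at hI
    obtain ⟨K, hK⟩ := hθ.smooth.continuous.bounded_above_of_compact_support hθ.cptsupp
    refine (hI.bdd_mul (c := K) hθ.smooth.continuous.aestronglyMeasurable
      (Eventually.of_forall hK)).congr ?_
    filter_upwards [hae] with x hx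
    by_cases hxR : x ∈ Metric.ball (0 : Euc d) R
    · simp [Set.indicator, hxR, h1 x hx]
    · have : θ x = 0 := (hR x (by simpa using hxR)).self_of_nhds
      simp [this]

/-- `‖χ(λD)Γ‖_{L^1} = ‖ψ_λ * Γ‖_{L^1} → 0` as `λ → +∞`; quantitatively
it is `≤ C λ^{-1} log λ` for `d = 2` and `≤ C λ^{-1}` for `d ≥ 3`, for all `λ ≥ 2`. -/
theorem Gamma_lowfreq_L1_decay
    (d : ℕ) (hd : 2 ≤ d)
    (χ : Euc d → ℝ) (hχ : IsCutoff d χ)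
    (ψ : 𝓢(Euc d, ℝ))
    (hψ : ∀ ξ : Euc d, 𝓕 (fun x => (ψ x : ℂ)) ξ = (χ ξ : ℂ))
    (E : Euc d → ℝ) (hE : IsFundSol d E)
    (θ : Euc d → ℝ) (hθ : IsBump d θ)
    (j k l : Fin d) :
    Tendsto
      (fun lam : ℝ => eLpNorm (cvS (dil (⇑ψ) lam) (Gam (⇑ψ) E θ j k l)) 1 volume)
      atTop (𝓝 0) ∧
    ∃ C : ℝ, 0 ≤ C ∧ ∀ lam : ℝ, 2 ≤ lam →
      (d = 2 →
        eLpNorm (cvS (dil (⇑ψ) lam) (Gam (⇑ψ) E θ j k l)) 1 volume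
          ≤ ENNReal.ofReal (C * Real.log lam / lam)) ∧
      (3 ≤ d →
        eLpNorm (cvS (dil (⇑ψ) lam) (Gam (⇑ψ) E θ j k l)) 1 volume
          ≤ ENNReal.ofReal (C / lam)) := by
  obtain ⟨C0, hC0, hEH⟩ := E_hyp hd hE
  obtain ⟨K1, K2, hK1, hK2, hK⟩ := gam_bound hEH hθ j k l ψ
  set N := ∫ x, ‖ψ x‖ with hN
  have hN0 : 0 ≤ N := by positivity
  have main : ∀ s : ℝ, 0 < s →
      eLpNorm (cvS (dil (⇑ψ) s) (Gam (⇑ψ) E θ j k l)) 1 volume ≤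
        ENNReal.ofReal (N * (s⁻¹ * K1 + |C0 * Real.log s| * (s ^ d / s ^ 3) * K2)) := by
    intro s hs
    obtain ⟨φ, hφ⟩ := dil_schwartz ψ hs
    obtain ⟨hi, hb⟩ := hK s hs
    have h1 := gam_swap hEH hθ j k l φ ψ
    rw [cv_congr (EventuallyEq.refl _ _) (gam_indep hEH hθ (bump_dil hθ hs) j k l φ), hφ] at h1
    rw [eLpNorm_congr_ae h1, eLpNorm_one_eq_lintegral_enorm,
      ← ofReal_integral_norm_eq_lintegral_enorm (cv_integrable ψ.integrable hi)]
    refine ENNReal.ofReal_le_ofReal ((cv_norm_le ψ.integrable hi).trans ?_)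
    exact mul_le_mul_of_nonneg_left hb hN0
  have l2 : 0 < Real.log 2 := Real.log_pos (by norm_num)
  set C := N * K1 / Real.log 2 + N * |C0| * K2 + N * K1 with hC
  have hCn : 0 ≤ C := by positivity
  have q : ∀ lam : ℝ, 2 ≤ lam →
      (d = 2 →
        eLpNorm (cvS (dil (⇑ψ) lam) (Gam (⇑ψ) E θ j k l)) 1 volume
          ≤ ENNReal.ofReal (C * Real.log lam / lam)) ∧
      (3 ≤ d →
        eLpNorm (cvS (dil (⇑ψ) lam) (Gam (⇑ψ) E θ j k l)) 1 volume
          ≤ ENNReal.ofReal (C / lam)) := by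
    intro s hs
    have hs0 : 0 < s := by linarith
    have hls : Real.log 2 ≤ Real.log s := Real.log_le_log (by norm_num) hs
    refine ⟨fun h2 => (main s hs0).trans (ENNReal.ofReal_le_ofReal ?_),
      fun h3 => (main s hs0).trans (ENNReal.ofReal_le_ofReal ?_)⟩
    · have e : s ^ d / s ^ 3 = s⁻¹ := by
        rw [h2]; field_simp
      rw [e, abs_mul, abs_of_nonneg (a := Real.log s) (by linarith), div_eq_mul_inv]
      have : N * K1 ≤ N * K1 / Real.log 2 * Real.log s := by
        rw [div_mul_eq_mul_div, le_div_iff₀ l2]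
        exact mul_le_mul_of_nonneg_left hls (by positivity)
      have h5 : 0 ≤ N * K1 * Real.log s := by
        have : 0 ≤ Real.log s := by linarith
        positivity
      calc N * (s⁻¹ * K1 + |C0| * Real.log s * s⁻¹ * K2)
          = (N * K1 + N * |C0| * K2 * Real.log s) * s⁻¹ := by ring
        _ ≤ (C * Real.log s) * s⁻¹ := by
          refine mul_le_mul_of_nonneg_right ?_ (by positivity)
          rw [hC]
          nlinarith
    · rw [hC0 h3]
      simp only [zero_mul, abs_zero, add_zero]
      rw [← mul_assoc, mul_comm N, mul_assoc, div_eq_mul_inv, mul_comm]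
      refine mul_le_mul_of_nonneg_right ?_ (by positivity)
      rw [hC]
      have : 0 ≤ N * K1 / Real.log 2 + N * |C0| * K2 := by positivity
      linarith
  refine ⟨?_, C, hCn, q⟩
  rcases hd.eq_or_lt with h2 | h3
  · have t0 : Tendsto (fun s : ℝ => C * Real.log s / s) atTop (𝓝 0) := by
      have h := (Real.isLittleO_log_id_atTop.tendsto_div_nhds_zero).const_mul C
      simpa [mul_div_assoc] using h
    have t1 := ENNReal.tendsto_ofReal t0
    rw [ENNReal.ofReal_zero] at t1
    refine tendsto_of_tendsto_of_tendsto_of_le_of_le' tendsto_const_nhds t1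
      (Eventually.of_forall fun _ => zero_le) ?_
    filter_upwards [eventually_ge_atTop 2] with s hs
    exact (q s hs).1 h2.symm
  · have t0 : Tendsto (fun s : ℝ => C / s) atTop (𝓝 0) := tendsto_const_nhds.div_atTop tendsto_id
    have t1 := ENNReal.tendsto_ofReal t0
    rw [ENNReal.ofReal_zero] at t1
    refine tendsto_of_tendsto_of_tendsto_of_le_of_le' tendsto_const_nhds t1
      (Eventually.of_forall fun _ => zero_le) ?_
    filter_upwards [eventually_ge_atTop 2] with s hs
    exact (q s hs).2 h3

end
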